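/- arXiv:2502.00403 — 2 statements merged into one kernel-verified Lean document; each statement's English description precedes it below -/
import Mathlib

section
/- In the Martinet sub-Riemannian structure on ℝ³ (horizontality: η₃'(t) = η₂'(t)·η₁(t)² a.e.; length: L(η) = ∫ √(η₁'² + η₂'²)), for every ε > 0 the abnormal curve α_ε(t) = (0, t, 0), t ∈ [0,ε], is length-minimizing: every τ > 0 and every absolutely continuous curve η : [0,τ] → ℝ³ with η₃' = η₂'·η₁² a.e., η(0) = (0,0,0), and η(τ) = (0, ε, 0) satisfies L(η) ≥ ε = L(α_ε). -/
open MeasureTheory Set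

/-- A horizontal curve of the Martinet sub-Riemannian structure on `ℝ³`, spanned by the
orthonormal frame `X₁ = ∂_{x₁}`, `X₂ = ∂_{x₂} + x₁²∂_{x₃}`: an absolutely continuous curve
`(x,y,z)` with a.e. derivatives `(d1, d2, d2·x²)`. -/
structure MartinetCurve (τ : ℝ) where
  x : ℝ → ℝ
  y : ℝ → ℝ
  z : ℝ → ℝ
  d1 : ℝ → ℝ
  d2 : ℝ → ℝ
  hd1 : IntervalIntegrable d1 volume 0 τ
  hd2 : IntervalIntegrable d2 volume 0 τ
  hx : ∀ t ∈ Icc (0:ℝ) τ, x t = x 0 + ∫ s in (0:ℝ)..t, d1 s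
  hy : ∀ t ∈ Icc (0:ℝ) τ, y t = y 0 + ∫ s in (0:ℝ)..t, d2 s
  hz : ∀ t ∈ Icc (0:ℝ) τ, z t = z 0 + ∫ s in (0:ℝ)..t, d2 s * (x s) ^ 2

/-- The sub-Riemannian length, i.e. the Euclidean length of the planar projection. -/
noncomputable def MartinetCurve.length {τ : ℝ} (η : MartinetCurve τ) : ℝ :=
  ∫ t in (0:ℝ)..τ, Real.sqrt (η.d1 t ^ 2 + η.d2 t ^ 2)

/-- the Martinet example. For every `ε > 0` the abnormal curve
`α_ε(t) = (0, t, 0)` is length-minimizing in the Martinet structure: every horizontal curve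
from `(0,0,0)` to `(0,ε,0)` has length at least `ε = L(α_ε)`. -/
theorem martinet_abnormal_minimizing (ε : ℝ) (hε : 0 < ε) :
    ∀ τ : ℝ, 0 < τ → ∀ η : MartinetCurve τ,
      η.x 0 = 0 → η.y 0 = 0 → η.z 0 = 0 →
      η.x τ = 0 → η.y τ = ε → η.z τ = 0 →
      ε ≤ η.length := by
  intro τ hτ η _ hy0 _ _ hyτ _
  have hint : IntervalIntegrable (fun t ↦ Real.sqrt (η.d1 t ^ 2 + η.d2 t ^ 2)) volume 0 τ := by
    refine (η.hd1.abs.add η.hd2.abs).mono_fun' ?_ (.of_forall fun t ↦ ?_)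
    · exact Real.continuous_sqrt.comp_aestronglyMeasurable
        ((η.hd1.def'.aestronglyMeasurable.pow 2).add (η.hd2.def'.aestronglyMeasurable.pow 2))
    · dsimp only
      rw [Real.norm_of_nonneg (Real.sqrt_nonneg _)]
      refine Real.sqrt_le_iff.mpr ⟨by positivity, ?_⟩
      nlinarith [sq_abs (η.d1 t), sq_abs (η.d2 t),
        mul_nonneg (abs_nonneg (η.d1 t)) (abs_nonneg (η.d2 t))]
  have hd2 : ε = ∫ t in (0:ℝ)..τ, η.d2 t := by
    simpa [hy0, hyτ] using η.hy τ ⟨hτ.le, le_rfl⟩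
  rw [hd2]
  exact intervalIntegral.integral_mono hτ.le η.hd2 hint fun t ↦
    Real.le_sqrt_of_sq_le (le_add_of_nonneg_left (sq_nonneg _))
end

section
/- Let a, b be natural numbers with b > a ≥ 1 such that a does not divide b, let q = b/a > 1, and let ε > 0. Define the arc-length function s(t) = ∫₀^t √(1 + q²·u^{2q−2}) du for t ∈ [0,ε], set Λ = s(ε), and let τ : [0,Λ] → [0,ε] be the inverse of s. Then the arc-length parameterization Γ : [0,Λ] → ℝ², Γ(σ) = (τ(σ)^q, τ(σ)), of the curve t ↦ (t^q, t) is of class C^{⌊q⌋} on [0,Λ] but is not of class C^{⌊q⌋+1} on any neighborhood of 0 in [0,Λ]; in particular, for a = 2 and b = 5 it is C² but not C³ at 0. -/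
open MeasureTheory Set

/-- On a compact interval `[0, δ]`, raising a `C^{m+1}` function vanishing linearly at the endpoint to a
power `r ∈ (m, m+1)` destroys `C^{m+1}` regularity. -/
theorem not_contDiffOn_rpow_of_derivWithin_pos {δ : ℝ} (hδ : 0 < δ) {f : ℝ → ℝ}
    (hf0 : f 0 = 0) (hfnn : ∀ x ∈ Icc 0 δ, 0 ≤ f x)
    (hf' : ∀ x ∈ Icc 0 δ, 0 < derivWithin f (Icc 0 δ) x) (m : ℕ)
    (hf : ContDiffOn ℝ (m + 1) f (Icc 0 δ)) {r : ℝ} (hmr : m < r) (hrm : r < m + 1) :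
    ¬ ContDiffOn ℝ (m + 1) (fun x => f x ^ r) (Icc 0 δ) := by
  have hu : UniqueDiffOn ℝ (Icc 0 δ) := uniqueDiffOn_Icc hδ
  have h0 : (0 : ℝ) ∈ Icc 0 δ := ⟨le_rfl, hδ.le⟩
  induction m generalizing r with
  | zero =>
    intro h
    simp only [Nat.cast_zero, zero_add] at *
    have hd : HasDerivWithinAt (fun x => f x ^ r) _ (Icc 0 δ) 0 :=
      (h.differentiableOn (by simp) 0 h0).hasDerivWithinAt
    have hd1 := hd.rpow_const (p := r⁻¹) (Or.inr ((one_le_inv₀ hmr).2 hrm.le))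
    have hz : (0 : ℝ) ^ (r⁻¹ - 1) = 0 :=
      Real.zero_rpow (sub_pos.2 ((one_lt_inv₀ hmr).2 hrm)).ne'
    simp only [hf0, Real.zero_rpow hmr.ne', hz, mul_zero] at hd1
    have hd2 : HasDerivWithinAt f 0 (Icc 0 δ) 0 :=
      hd1.congr_of_mem (fun x hx => (Real.rpow_rpow_inv (hfnn x hx) hmr.ne').symm) h0
    exact (hf' 0 h0).ne' (hd2.derivWithin (hu 0 h0))
  | succ m ih =>
    intro h
    push_cast at *
    have hr1 : 1 ≤ r := by linarith [(Nat.cast_nonneg m : (0 : ℝ) ≤ m)]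
    refine ih (hf.of_le le_self_add) (r := r - 1) (by linarith) (by linarith) ?_
    have hfd := (contDiffOn_succ_iff_derivWithin hu).1 hf
    have hrd := ((contDiffOn_succ_iff_derivWithin hu).1 h).2.2
    refine (hrd.div (contDiffOn_const (c := r) |>.mul hfd.2.2) fun x hx =>
      mul_ne_zero (by linarith) (hf' x hx).ne').congr fun x hx => ?_
    have hx' := (hf' x hx).ne'
    have hr0 : r ≠ 0 := by linarith
    rw [Pi.div_apply, derivWithin_rpow_const (hfd.1 x hx) (Or.inr hr1) (hu x hx)]
    field_simp

/-- A function whose derivative on `I` is `1 / √(1 + c f ^ p)` with `c ≥ 0` is `C^{k+1}` on `I`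
as soon as `k ≤ p`. -/
theorem contDiffOn_of_hasDerivWithinAt_inv_sqrt_rpow {I : Set ℝ} (hI : UniqueDiffOn ℝ I)
    {f : ℝ → ℝ} {c p : ℝ} (hc : 0 ≤ c) (hfnn : ∀ x ∈ I, 0 ≤ f x)
    (hf : ∀ x ∈ I, HasDerivWithinAt f (√(1 + c * f x ^ p))⁻¹ I x) (k : ℕ) (hk : k ≤ p) :
    ContDiffOn ℝ (k + 1) f I := by
  have hpos : ∀ x ∈ I, 0 < 1 + c * f x ^ p := fun x hx => by
    have := Real.rpow_nonneg (hfnn x hx) p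
    positivity
  have hdiff : DifferentiableOn ℝ f I := fun x hx => (hf x hx).differentiableWithinAt
  have step : ∀ k : ℕ, k ≤ p → ContDiffOn ℝ k f I → ContDiffOn ℝ (k + 1) f I := fun k hk h =>
    (contDiffOn_succ_iff_derivWithin hI).2 ⟨hdiff, by simp,
      (((contDiffOn_const.add (contDiffOn_const.mul (h.rpow_const_of_le hk))).sqrt
        fun x hx => (hpos x hx).ne').inv fun x hx => (Real.sqrt_pos.2 (hpos x hx)).ne').congr
        fun x hx => (hf x hx).derivWithin (hI x hx)⟩
  induction k with
  | zero => exact step 0 hk (by simpa using hdiff.continuousOn)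
  | succ k ih =>
    refine step (k + 1) hk ?_
    push_cast at *
    exact ih (by linarith)

/-- The inverse of a differentiable function on `[0, ε]` whose derivative is at least one. -/
theorem hasDerivWithinAt_inverse_of_one_le_deriv {ε : ℝ} {s s' τ : ℝ → ℝ}
    (hs : ∀ t, HasDerivAt s (s' t) t) (hs' : ∀ t ∈ Icc 0 ε, 1 ≤ s' t) {J : Set ℝ}
    (hτ : MapsTo τ J (Icc 0 ε)) (hsτ : ∀ σ ∈ J, s (τ σ) = σ) {σ : ℝ} (hσ : σ ∈ J) :
    HasDerivWithinAt τ (s' (τ σ))⁻¹ J σ := by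
  have hexp := (convex_Icc 0 ε).mul_sub_le_image_sub_of_le_deriv (f := s) (C := 1)
    (fun t _ => (hs t).continuousAt.continuousWithinAt)
    (fun t _ => (hs t).differentiableAt.differentiableWithinAt)
    fun t ht => (hs t).deriv ▸ hs' t (interior_subset ht)
  have hlip : LipschitzOnWith 1 τ J := LipschitzOnWith.of_dist_le_mul fun x hx y hy => by
    rw [NNReal.coe_one, one_mul, Real.dist_eq, Real.dist_eq]
    rcases le_total (τ x) (τ y) with h | h
    · have := hexp _ (hτ hx) _ (hτ hy) h
      rw [hsτ x hx, hsτ y hy] at this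
      rw [abs_sub_comm, abs_of_nonneg (sub_nonneg.2 h), abs_sub_comm]
      exact le_trans (by linarith) (le_abs_self _)
    · have := hexp _ (hτ hy) _ (hτ hx) h
      rw [hsτ x hx, hsτ y hy] at this
      rw [abs_of_nonneg (sub_nonneg.2 h)]
      exact le_trans (by linarith) (le_abs_self _)
  have h0 : s' (τ σ) ≠ 0 := (zero_lt_one.trans_le (hs' _ (hτ hσ))).ne'
  exact HasFDerivWithinAt.of_local_left_inverse
    (t := univ) (by simpa using (hlip.continuousOn σ hσ).tendsto)
    ((hs (τ σ)).hasFDerivAt_equiv h0).hasFDerivWithinAt hσ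
    (eventually_mem_nhdsWithin.mono hsτ)

/-- Let `b > a ≥ 1` with `a ∤ b` and `q = b/a > 1`. The arc-length
parameterization `Γ(σ) = (τ(σ)^q, τ(σ))` of the plane curve `t ↦ (t^q, t)`, `t ∈ [0,ε]`,
where `τ` is the inverse of the arc-length function `s(t) = ∫₀^t √(1+q²u^{2q−2}) du` and
`Λ = s(ε)`, is of class `C^⌊q⌋` on `[0,Λ]` but not of class `C^{⌊q⌋+1}` on any neighborhood
of `0` in `[0,Λ]`. -/
theorem arclength_regularity (a b : ℕ) (ha : 1 ≤ a) (hab : a < b) (hnd : ¬ a ∣ b)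
    (q : ℝ) (hq : q = (b : ℝ) / a) (ε : ℝ) (hε : 0 < ε)
    (s : ℝ → ℝ) (hs : ∀ t, s t = ∫ u in (0:ℝ)..t, Real.sqrt (1 + q ^ 2 * u ^ (2 * q - 2)))
    (Λ : ℝ) (hΛ : Λ = s ε)
    (τ : ℝ → ℝ) (hτ₁ : ∀ t ∈ Icc (0:ℝ) ε, τ (s t) = t)
    (hτ₂ : ∀ σ ∈ Icc (0:ℝ) Λ, s (τ σ) = σ) :
    ContDiffOn ℝ (⌊q⌋₊ : ℕ) (fun σ => ((τ σ) ^ q, τ σ)) (Icc (0:ℝ) Λ)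
    ∧ ∀ U ∈ nhdsWithin (0:ℝ) (Icc (0:ℝ) Λ),
        ¬ ContDiffOn ℝ ((⌊q⌋₊ : ℕ) + 1) (fun σ => ((τ σ) ^ q, τ σ)) U := by
  have ha0 : (0 : ℝ) < a := by exact_mod_cast ha
  have hq1 : 1 < q := by
    rw [hq, one_lt_div ha0]
    exact_mod_cast hab
  have hfl : (⌊q⌋₊ : ℝ) < q := by
    refine (Nat.floor_le (by linarith)).lt_of_ne fun h => hnd ⟨⌊q⌋₊, ?_⟩
    have : (a : ℝ) * ⌊q⌋₊ = b := by rw [h, hq]; field_simp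
    exact_mod_cast this.symm
  have hcont : Continuous fun u : ℝ => √(1 + q ^ 2 * u ^ (2 * q - 2)) :=
    (continuous_const.add (continuous_const.mul
      (Real.continuous_rpow_const (by linarith)))).sqrt
  have hsd : ∀ t, HasDerivAt s (√(1 + q ^ 2 * t ^ (2 * q - 2))) t := fun t => by
    rw [funext hs]
    exact (hcont.integral_hasStrictDerivAt 0 t).hasDerivAt
  have hsd1 : ∀ t, 0 ≤ t → 1 ≤ √(1 + q ^ 2 * t ^ (2 * q - 2)) := fun t ht => by
    have := Real.rpow_nonneg ht (2 * q - 2)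
    exact Real.one_le_sqrt.2 (le_add_of_nonneg_right (by positivity))
  have hs0 : s 0 = 0 := by simp [hs]
  have hτm : MapsTo τ (Icc 0 Λ) (Icc 0 ε) := fun σ hσ => by
    have : Icc (s 0) (s ε) ⊆ s '' Icc 0 ε := intermediate_value_Icc hε.le
      fun t _ => (hsd t).continuousAt.continuousWithinAt
    rw [hs0, ← hΛ] at this
    obtain ⟨t, ht, rfl⟩ := this hσ
    rwa [hτ₁ t ht]
  have hΛ0 : 0 < Λ := by
    rw [hΛ, hs]
    refine intervalIntegral.intervalIntegral_pos_of_pos_on (hcont.intervalIntegrable _ _)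
      (fun x hx => zero_lt_one.trans_le (hsd1 x hx.1.le)) hε
  have hτ0 : τ 0 = 0 := by simpa [hs0] using hτ₁ 0 ⟨le_rfl, hε.le⟩
  have hτd : ∀ σ ∈ Icc 0 Λ,
      HasDerivWithinAt τ (√(1 + q ^ 2 * τ σ ^ (2 * q - 2)))⁻¹ (Icc 0 Λ) σ := fun σ hσ =>
    hasDerivWithinAt_inverse_of_one_le_deriv hsd (fun t ht => hsd1 t ht.1) hτm hτ₂ hσ
  constructor
  · have hτC : ContDiffOn ℝ (⌊q⌋₊ : ℕ) τ (Icc 0 Λ) := by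
      obtain ⟨k, hk⟩ : ∃ k, ⌊q⌋₊ = k + 1 :=
        Nat.exists_eq_add_one.2 (Nat.floor_pos.2 hq1.le)
      rw [hk] at hfl ⊢
      push_cast at hfl ⊢
      exact contDiffOn_of_hasDerivWithinAt_inv_sqrt_rpow (uniqueDiffOn_Icc hΛ0) (sq_nonneg q)
        (fun σ hσ => (hτm hσ).1) hτd k (by linarith)
    exact (hτC.rpow_const_of_le hfl.le).prodMk hτC
  · intro U hU hC
    obtain ⟨δ, hδ, hδU⟩ : ∃ δ, 0 < δ ∧ Icc 0 δ ⊆ U ∩ Icc 0 Λ := by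
      rw [nhdsWithin_Icc_eq_nhdsGE hΛ0, mem_nhdsGE_iff_exists_Icc_subset] at hU
      obtain ⟨δ, hδ, hδU⟩ := hU
      exact ⟨min δ Λ, lt_min hδ hΛ0, fun x hx =>
        ⟨hδU ⟨hx.1, hx.2.trans (min_le_left _ _)⟩, hx.1, hx.2.trans (min_le_right _ _)⟩⟩
    have hC' := hC.mono (hδU.trans inter_subset_left)
    refine not_contDiffOn_rpow_of_derivWithin_pos hδ hτ0 (fun σ hσ => (hτm (hδU hσ).2).1)
      (fun σ hσ => ?_) ⌊q⌋₊ hC'.snd hfl (Nat.lt_floor_add_one q) hC'.fst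
    rw [((hτd σ (hδU hσ).2).mono (hδU.trans inter_subset_right)).derivWithin
      (uniqueDiffOn_Icc hδ σ hσ)]
    exact inv_pos.2 (zero_lt_one.trans_le (hsd1 _ (hτm (hδU hσ).2).1))
end
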